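/- Let f : 2^{[k]} → ℝ be submodular, increasing, and normalized, and fix ε > 0. Then for every u ∈ ℝ^k and every probability distribution p on Y = {−1,1}^k such that inf_{u* ∈ Γ_{L^f}(p)} ‖u* − u‖_∞ < ε, we have Ψ̂(u) ⊆ Γ_{L^f}(p) ∩ {−1,0,1}^k; equivalently, Ψ̂(u) ⊆ Ψ^f(u) for all u, where Ψ^f(u) = ⋂{Γ_{L^f}(p) ∩ {−1,0,1}^k : p a probability distribution on Y with inf_{u* ∈ Γ_{L^f}(p)} ‖u* − u‖_∞ < ε}. -/

import Mathlib

open Finset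

noncomputable section

/-- The set {π(1),…,π(i)} of the first `i` elements under permutation `π`. -/
def Spi (k : ℕ) (π : Equiv.Perm (Fin k)) (i : ℕ) : Finset (Fin k) :=
  (Finset.univ.filter (fun m : Fin k => (m : ℕ) < i)).image π

/-- The Lovász extension of a set function `f`. -/
def lovaszExt (k : ℕ) (f : Finset (Fin k) → ℝ) (x : Fin k → ℝ) : ℝ :=
  Finset.univ.sup' Finset.univ_nonempty
    (fun π : Equiv.Perm (Fin k) =>
      ∑ i : Fin k, x (π i) * (f (Spi k π ((i : ℕ) + 1)) - f (Spi k π (i : ℕ))))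

/-- The Lovász hinge `L^f(u,y) = F((𝟙 - u ⊙ y)₊)`. -/
def lovaszHinge (k : ℕ) (f : Finset (Fin k) → ℝ) (u y : Fin k → ℝ) : ℝ :=
  lovaszExt k f (fun i => max (1 - u i * y i) 0)

/-- Componentwise clipping of `u` to `[-1,1]^k`. -/
def clip {k : ℕ} (u : Fin k → ℝ) : Fin k → ℝ := fun i => Real.sign (u i) * min |u i| 1

/-- The indicator vector `𝟙_{π,i}` of `{π(1),…,π(i)}`. -/
def onespi (k : ℕ) (π : Equiv.Perm (Fin k)) (i : ℕ) : Fin k → ℝ :=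
  fun j => if j ∈ Spi k π i then 1 else 0

/-- `V^face`: all subsets of some `V_{π,y}`. -/
def Vface (k : ℕ) : Set (Set (Fin k → ℝ)) :=
  {V' | ∃ (π : Equiv.Perm (Fin k)) (y : Fin k → ℝ), (∀ i, y i = -1 ∨ y i = 1) ∧
      V' ⊆ {v | ∃ i ≤ k, v = fun j => onespi k π i j * y j}}

/-- The link envelope `Ψ̂(u)`: the intersection of all `V' ∈ V^face` whose convex hull is
within sup-distance `ε` of the clipped point `⌊u⌉`. -/
def psiHat (k : ℕ) (ε : ℝ) (u : Fin k → ℝ) : Set (Fin k → ℝ) :=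
  ⋂₀ {V' | V' ∈ Vface k ∧ ∃ a ∈ convexHull ℝ V', ‖a - clip u‖ < ε}

/-- The `±1` vector associated with a Boolean vector, indexing the outcome space `Y = {-1,1}^k`. -/
def ytov (k : ℕ) (b : Fin k → Bool) : Fin k → ℝ := fun i => if b i then 1 else -1

/-- `p` is a probability distribution on `Y = {-1,1}^k`. -/
def IsProb (k : ℕ) (p : (Fin k → ℝ) → ℝ) : Prop :=
  (∀ b : Fin k → Bool, 0 ≤ p (ytov k b)) ∧ ∑ b : Fin k → Bool, p (ytov k b) = 1

/-- Expected Lovász hinge loss `L^f(u; p)`. -/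
def expLossL (k : ℕ) (f : Finset (Fin k) → ℝ) (u : Fin k → ℝ) (p : (Fin k → ℝ) → ℝ) : ℝ :=
  ∑ b : Fin k → Bool, p (ytov k b) * lovaszHinge k f u (ytov k b)

/-- The property elicited by the Lovász hinge: minimizers of `L^f(·; p)` over `ℝ^k`. -/
def GammaL (k : ℕ) (f : Finset (Fin k) → ℝ) (p : (Fin k → ℝ) → ℝ) : Set (Fin k → ℝ) :=
  {u | ∀ u' : Fin k → ℝ, expLossL k f u p ≤ expLossL k f u' p}

/-- The linear functional attached to the permutation `π` in the Lovász extension. -/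
def greedySum (k : ℕ) (f : Finset (Fin k) → ℝ) (π : Equiv.Perm (Fin k)) (x : Fin k → ℝ) : ℝ :=
  ∑ i : Fin k, x (π i) * (f (Spi k π ((i : ℕ) + 1)) - f (Spi k π (i : ℕ)))

/-- The 0/1 indicator vector of a finite set of coordinates. -/
def indVec {k : ℕ} (A : Finset (Fin k)) : Fin k → ℝ := fun j => if j ∈ A then 1 else 0

lemma mem_Spi {k : ℕ} (π : Equiv.Perm (Fin k)) (i : ℕ) (j : Fin k) :
    j ∈ Spi k π i ↔ (π.symm j : ℕ) < i := by
  simp only [Spi, mem_image, mem_filter, mem_univ, true_and]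
  constructor
  · rintro ⟨a, ha, rfl⟩
    simpa using ha
  · intro h
    exact ⟨π.symm j, h, by simp⟩

lemma Spi_zero {k : ℕ} (π : Equiv.Perm (Fin k)) : Spi k π 0 = ∅ := by
  simp [Spi]

lemma Spi_card {k : ℕ} (π : Equiv.Perm (Fin k)) : Spi k π k = univ := by
  ext j
  simp [mem_Spi]

lemma Spi_succ {k : ℕ} (π : Equiv.Perm (Fin k)) (i : Fin k) :
    Spi k π ((i : ℕ) + 1) = insert (π i) (Spi k π i) := by
  ext j
  rw [mem_insert, mem_Spi, mem_Spi, ← Equiv.symm_apply_eq, Fin.ext_iff]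
  omega

lemma greedySum_le_lovaszExt {k : ℕ} (f : Finset (Fin k) → ℝ) (π : Equiv.Perm (Fin k))
    (x : Fin k → ℝ) : greedySum k f π x ≤ lovaszExt k f x :=
  Finset.le_sup' (fun π => greedySum k f π x) (mem_univ π)

lemma lovaszExt_le_iff {k : ℕ} (f : Finset (Fin k) → ℝ) (x : Fin k → ℝ) (c : ℝ) :
    lovaszExt k f x ≤ c ↔ ∀ π, greedySum k f π x ≤ c := by
  simp [lovaszExt, greedySum]

lemma greedySum_add {k : ℕ} (f : Finset (Fin k) → ℝ) (π : Equiv.Perm (Fin k))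
    (x y : Fin k → ℝ) :
    greedySum k f π (fun j => x j + y j) = greedySum k f π x + greedySum k f π y := by
  simp only [greedySum, ← sum_add_distrib, add_mul]

lemma greedySum_sum {k : ℕ} (f : Finset (Fin k) → ℝ) (π : Equiv.Perm (Fin k)) {ι : Type*}
    (s : Finset ι) (w : ι → ℝ) (x : ι → Fin k → ℝ) :
    greedySum k f π (fun j => ∑ i ∈ s, w i * x i j) = ∑ i ∈ s, w i * greedySum k f π (x i) := by
  simp only [greedySum, mul_sum, sum_mul]
  rw [sum_comm]
  simp only [mul_assoc]

/-- The Lovász extension of an increasing function is monotone. -/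
lemma lovaszExt_mono {k : ℕ} {f : Finset (Fin k) → ℝ}
    (hinc : ∀ S T : Finset (Fin k), Disjoint S T → f S ≤ f (S ∪ T))
    {x y : Fin k → ℝ} (hxy : ∀ i, x i ≤ y i) : lovaszExt k f x ≤ lovaszExt k f y := by
  rw [lovaszExt_le_iff]
  intro π
  refine le_trans (sum_le_sum fun i _ => ?_) (greedySum_le_lovaszExt f π y)
  refine mul_le_mul_of_nonneg_right (hxy _) (sub_nonneg.2 ?_)
  rw [Spi_succ, insert_eq, union_comm]
  refine hinc _ _ ?_
  simp [mem_Spi]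

/-- For submodular `f`, every permutation sum of an indicator vector is at most `f A`. -/
lemma greedySum_indVec_le {k : ℕ} {f : Finset (Fin k) → ℝ}
    (hsub : ∀ S T : Finset (Fin k), f (S ∪ T) + f (S ∩ T) ≤ f S + f T) (hnorm : f ∅ = 0)
    (π : Equiv.Perm (Fin k)) (A : Finset (Fin k)) : greedySum k f π (indVec A) ≤ f A := by
  have tele : ∑ i : Fin k, (f (A ∩ Spi k π ((i : ℕ) + 1)) - f (A ∩ Spi k π (i : ℕ))) = f A := by
    rw [Fin.sum_univ_eq_sum_range
      (fun i => f (A ∩ Spi k π (i + 1)) - f (A ∩ Spi k π i)) k,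
      sum_range_sub (fun i => f (A ∩ Spi k π i)), Spi_zero, Spi_card]
    simp [hnorm]
  rw [← tele]
  refine sum_le_sum fun i _ => ?_
  rw [Spi_succ]
  by_cases h : π i ∈ A
  · have h1 : (A ∩ insert (π i) (Spi k π i)) ∪ Spi k π i = insert (π i) (Spi k π i) := by
      grind
    have h2 : (A ∩ insert (π i) (Spi k π i)) ∩ Spi k π i = A ∩ Spi k π i := by
      grind
    have := hsub (A ∩ insert (π i) (Spi k π i)) (Spi k π i)
    rw [h1, h2] at this
    simp only [indVec, h, if_true]
    linarith
  · have h1 : A ∩ insert (π i) (Spi k π i) = A ∩ Spi k π i := by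
      grind
    simp [indVec, h, h1]

/-- The permutation sum of the indicator vector of a prefix of `π` is the value of `f`. -/
lemma greedySum_indVec_Spi {k : ℕ} {f : Finset (Fin k) → ℝ} (hnorm : f ∅ = 0)
    (π : Equiv.Perm (Fin k)) {m : ℕ} (hm : m ≤ k) :
    greedySum k f π (indVec (Spi k π m)) = f (Spi k π m) := by
  have h : greedySum k f π (indVec (Spi k π m)) =
      ∑ i ∈ range k, if i < m then f (Spi k π (i + 1)) - f (Spi k π i) else 0 := by
    rw [← Fin.sum_univ_eq_sum_range
      (fun i => if i < m then f (Spi k π (i + 1)) - f (Spi k π i) else 0) k]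
    refine sum_congr rfl fun i _ => ?_
    simp [indVec, mem_Spi]
  have hr : (range k).filter (· < m) = range m := by
    ext i
    simp only [mem_filter, mem_range]
    omega
  rw [h, ← sum_filter, hr, sum_range_sub (fun i => f (Spi k π i)), Spi_zero, hnorm, sub_zero]

/-- A set of coordinates closed downwards for `key` is a prefix of the sorting permutation. -/
lemma eq_Spi_sort {k : ℕ} (key : Fin k → ℤ) (A : Finset (Fin k))
    (hA : ∀ a ∈ A, ∀ b, b ∉ A → key a < key b) :
    ∃ m ≤ k, A = Spi k (Tuple.sort key) m := by
  set σ := Tuple.sort key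
  have hσ : Monotone (key ∘ σ) := Tuple.monotone_sort key
  by_cases hne : ∃ n : Fin k, σ n ∉ A
  · obtain ⟨n, hn, hmin⟩ := WellFounded.has_min (wellFounded_lt (α := Fin k))
      {n | σ n ∉ A} hne
    refine ⟨n, n.2.le, ?_⟩
    ext j
    rw [mem_Spi]
    constructor
    · intro hj
      by_contra hlt
      have h1 : n ≤ σ.symm j := not_lt.1 hlt
      have h2 := hσ h1
      simp only [Function.comp, Equiv.apply_symm_apply] at h2
      exact absurd (hA j hj _ hn) (not_lt.2 h2)
    · intro hj
      by_contra hjA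
      exact hmin (σ.symm j) (by simpa using hjA) hj
  · push Not at hne
    refine ⟨k, le_rfl, ?_⟩
    rw [Spi_card]
    ext j
    simpa using hne (σ.symm j)

/-- For submodular `f`, if two level sets are prefixes of `σ` then the permutation sum
along `σ` attains the Lovász extension at the sum of their indicator vectors. -/
lemma lovaszExt_le_greedySum {k : ℕ} {f : Finset (Fin k) → ℝ}
    (hsub : ∀ S T : Finset (Fin k), f (S ∪ T) + f (S ∩ T) ≤ f S + f T) (hnorm : f ∅ = 0)
    (σ : Equiv.Perm (Fin k)) {m n : ℕ} (hm : m ≤ k) (hn : n ≤ k) :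
    lovaszExt k f (fun j => indVec (Spi k σ m) j + indVec (Spi k σ n) j) ≤
      greedySum k f σ (fun j => indVec (Spi k σ m) j + indVec (Spi k σ n) j) := by
  rw [lovaszExt_le_iff]
  intro π
  rw [greedySum_add, greedySum_add, greedySum_indVec_Spi hnorm σ hm,
    greedySum_indVec_Spi hnorm σ hn]
  exact add_le_add (greedySum_indVec_le hsub hnorm π _) (greedySum_indVec_le hsub hnorm π _)

/-- The sorting key of the coordinates: coordinates where `y` and `y'` disagree come first, in
the order of `π`, followed by those where they agree, in the reverse order. -/
def hingeKey {k : ℕ} (π : Equiv.Perm (Fin k)) (y y' : Fin k → ℝ) : Fin k → ℤ :=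
  fun j => if y j = y' j then 2 * k - (π.symm j : ℕ) else (π.symm j : ℕ)

/-- The margin vector at a vertex of `V_{π,y}` is a sum of two prefix indicators of a
permutation that does not depend on the vertex. -/
lemma exists_prefix_margin {k : ℕ} (π : Equiv.Perm (Fin k)) {y y' : Fin k → ℝ}
    (hy : ∀ i, y i = -1 ∨ y i = 1) (hy' : ∀ i, y' i = -1 ∨ y' i = 1) (i : ℕ) :
    ∃ m ≤ k, ∃ n ≤ k, ∀ j, 1 - onespi k π i j * y j * y' j =
      indVec (Spi k (Tuple.sort (hingeKey π y y')) m) j +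
        indVec (Spi k (Tuple.sort (hingeKey π y y')) n) j := by
  classical
  obtain ⟨m, hm, hA⟩ := eq_Spi_sort (hingeKey π y y')
    (univ.filter fun j => y j ≠ y' j ∨ i ≤ (π.symm j : ℕ)) (by
      intro a ha b hb
      simp only [mem_filter, mem_univ, true_and] at ha hb
      have := (π.symm a).2
      have := (π.symm b).2
      unfold hingeKey
      grind)
  obtain ⟨n, hn, hB⟩ := eq_Spi_sort (hingeKey π y y')
    (univ.filter fun j => y j ≠ y' j ∧ (π.symm j : ℕ) < i) (by
      intro a ha b hb
      simp only [mem_filter, mem_univ, true_and] at ha hb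
      have := (π.symm a).2
      have := (π.symm b).2
      unfold hingeKey
      grind)
  refine ⟨m, hm, n, hn, fun j => ?_⟩
  rw [← hA, ← hB]
  simp only [indVec, onespi, mem_Spi, mem_filter, mem_univ, true_and]
  by_cases hi : (π.symm j : ℕ) < i
  · rcases hy j with h | h <;> rcases hy' j with h' | h' <;> norm_num [h, h', hi]
  · simp [hi, not_lt.1 hi]

/-- The Lovász hinge is concave (hence affine) on the convex hull of `V_{π,y}`. -/
lemma sum_lovaszHinge_le {k : ℕ} {f : Finset (Fin k) → ℝ}
    (hsub : ∀ S T : Finset (Fin k), f (S ∪ T) + f (S ∩ T) ≤ f S + f T) (hnorm : f ∅ = 0)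
    (π : Equiv.Perm (Fin k)) {y y' : Fin k → ℝ}
    (hy : ∀ i, y i = -1 ∨ y i = 1) (hy' : ∀ i, y' i = -1 ∨ y' i = 1)
    (s : Finset ℕ) (w : ℕ → ℝ) (hw : ∀ i ∈ s, 0 ≤ w i) (hw1 : ∑ i ∈ s, w i = 1) :
    ∑ i ∈ s, w i * lovaszHinge k f (fun j => onespi k π i j * y j) y' ≤
      lovaszHinge k f (fun j => ∑ i ∈ s, w i * (onespi k π i j * y j)) y' := by
  set σ := Tuple.sort (hingeKey π y y')
  have hnn : ∀ i j, 0 ≤ 1 - onespi k π i j * y j * y' j := by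
    intro i j
    obtain ⟨m, -, n, -, h⟩ := exists_prefix_margin π hy hy' i
    rw [h]
    unfold indVec
    positivity
  have hmargin : (fun j => max (1 - (∑ i ∈ s, w i * (onespi k π i j * y j)) * y' j) 0) =
      fun j => ∑ i ∈ s, w i * max (1 - onespi k π i j * y j * y' j) 0 := by
    funext j
    have h : 1 - (∑ i ∈ s, w i * (onespi k π i j * y j)) * y' j =
        ∑ i ∈ s, w i * (1 - onespi k π i j * y j * y' j) := by
      simp only [mul_sub, mul_one, sum_sub_distrib, hw1, sum_mul, mul_assoc]
    rw [h, max_eq_left (sum_nonneg fun i hi => mul_nonneg (hw i hi) (hnn i j))]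
    exact sum_congr rfl fun i _ => by rw [max_eq_left (hnn i j)]
  unfold lovaszHinge
  rw [hmargin]
  refine le_trans ?_ (greedySum_le_lovaszExt f σ _)
  rw [greedySum_sum]
  refine sum_le_sum fun i hi => mul_le_mul_of_nonneg_left ?_ (hw i hi)
  obtain ⟨m, hm, n, hn, h⟩ := exists_prefix_margin π hy hy' i
  have hx : (fun j => max (1 - onespi k π i j * y j * y' j) 0) =
      fun j => indVec (Spi k σ m) j + indVec (Spi k σ n) j := by
    funext j
    rw [max_eq_left (hnn i j), h]
  rw [hx]
  exact lovaszExt_le_greedySum hsub hnorm σ hm hn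

lemma ytov_eq {k : ℕ} (b : Fin k → Bool) (i : Fin k) : ytov k b i = -1 ∨ ytov k b i = 1 := by
  unfold ytov
  grind

lemma sum_expLossL_le {k : ℕ} {f : Finset (Fin k) → ℝ}
    (hsub : ∀ S T : Finset (Fin k), f (S ∪ T) + f (S ∩ T) ≤ f S + f T) (hnorm : f ∅ = 0)
    {p : (Fin k → ℝ) → ℝ} (hp : ∀ b : Fin k → Bool, 0 ≤ p (ytov k b))
    (π : Equiv.Perm (Fin k)) {y : Fin k → ℝ} (hy : ∀ i, y i = -1 ∨ y i = 1)
    (s : Finset ℕ) (w : ℕ → ℝ) (hw : ∀ i ∈ s, 0 ≤ w i) (hw1 : ∑ i ∈ s, w i = 1) :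
    ∑ i ∈ s, w i * expLossL k f (fun j => onespi k π i j * y j) p ≤
      expLossL k f (fun j => ∑ i ∈ s, w i * (onespi k π i j * y j)) p := by
  simp only [expLossL, mul_sum]
  rw [sum_comm]
  refine sum_le_sum fun b _ => ?_
  calc _ = p (ytov k b) *
        ∑ i ∈ s, w i * lovaszHinge k f (fun j => onespi k π i j * y j) (ytov k b) := by
        rw [mul_sum]
        exact sum_congr rfl fun i _ => by ring
    _ ≤ _ := mul_le_mul_of_nonneg_left
        (sum_lovaszHinge_le hsub hnorm π hy (ytov_eq b) s w hw hw1) (hp b)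

lemma clip_apply {k : ℕ} (u : Fin k → ℝ) (i : Fin k) : clip u i = max (-1) (min 1 (u i)) := by
  unfold clip
  rcases lt_trichotomy (u i) 0 with h | h | h
  · rw [Real.sign_of_neg h, abs_of_neg h]
    grind
  · simp [h]
  · rw [Real.sign_of_pos h, abs_of_pos h]
    grind

lemma clip_mem_GammaL {k : ℕ} {f : Finset (Fin k) → ℝ}
    (hinc : ∀ S T : Finset (Fin k), Disjoint S T → f S ≤ f (S ∪ T))
    {p : (Fin k → ℝ) → ℝ} (hp : ∀ b : Fin k → Bool, 0 ≤ p (ytov k b))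
    {u : Fin k → ℝ} (hu : u ∈ GammaL k f p) : clip u ∈ GammaL k f p := by
  intro u'
  refine le_trans (sum_le_sum fun b _ => mul_le_mul_of_nonneg_left ?_ (hp b)) (hu u')
  refine lovaszExt_mono hinc fun i => ?_
  rw [clip_apply]
  rcases ytov_eq b i with h | h <;> rw [h] <;> grind

lemma norm_clip_sub_clip_lt {k : ℕ} {u v : Fin k → ℝ} {ε : ℝ} (hε : 0 < ε)
    (h : ‖u - v‖ < ε) : ‖clip u - clip v‖ < ε := by
  rw [pi_norm_lt_iff hε] at h ⊢
  intro i
  have := h i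
  rw [Pi.sub_apply, Real.norm_eq_abs] at this ⊢
  rw [clip_apply, clip_apply]
  rw [abs_lt] at this ⊢
  grind

/-- Every point of the cube `[-1,1]^k` is a convex combination of some `V_{π,y}`. -/
lemma exists_convex_decomposition {k : ℕ} {v : Fin k → ℝ} (hv : ∀ i, |v i| ≤ 1) :
    ∃ (π : Equiv.Perm (Fin k)) (y : Fin k → ℝ) (w : ℕ → ℝ), (∀ i, y i = -1 ∨ y i = 1) ∧
      (∀ i ∈ range (k + 1), 0 ≤ w i) ∧ ∑ i ∈ range (k + 1), w i = 1 ∧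
      v = fun j => ∑ i ∈ range (k + 1), w i * (onespi k π i j * y j) := by
  set π := Tuple.sort (fun i => -|v i|)
  have hπ : Monotone ((fun i => -|v i|) ∘ π) := Tuple.monotone_sort _
  let d : ℕ → ℝ := fun i => if i = 0 then 1 else if h : i - 1 < k then |v (π ⟨i - 1, h⟩)| else 0
  have hd0 : d 0 = 1 := by simp [d]
  have hdk : d (k + 1) = 0 := by simp [d]
  have hd : ∀ r : Fin k, d (r + 1) = |v (π r)| := by simp [d]
  refine ⟨π, fun i => if v i < 0 then -1 else 1, fun i => d i - d (i + 1), ?_, ?_, ?_, ?_⟩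
  · intro i
    dsimp only
    split_ifs <;> simp
  · intro i hi
    rw [mem_range] at hi
    rw [sub_nonneg]
    rcases Nat.lt_succ_iff_lt_or_eq.1 hi with hik | rfl
    · rw [hd ⟨i, hik⟩]
      rcases i with _ | i
      · rw [hd0]
        exact hv _
      · rw [hd ⟨i, by omega⟩]
        have := @hπ ⟨i, by omega⟩ ⟨i + 1, hik⟩ (by simp [Fin.le_def])
        simpa using this
    · rw [hdk]
      simp only [d]
      split_ifs <;> positivity
  · rw [sum_range_sub', hd0, hdk, sub_zero]
  · funext j
    have hj := (π.symm j).2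
    have hsum : ∑ i ∈ range (k + 1), (d i - d (i + 1)) * onespi k π i j = |v j| := by
      have hf : (range (k + 1)).filter (fun i => (π.symm j : ℕ) < i) =
          Ico ((π.symm j : ℕ) + 1) (k + 1) := by
        ext i
        simp only [mem_filter, mem_range, mem_Ico]
        omega
      simp only [onespi, mem_Spi, mul_ite, mul_one, mul_zero]
      rw [← sum_filter, hf, ← neg_inj, ← sum_neg_distrib]
      simp only [neg_sub]
      rw [sum_Ico_sub d (by omega), hdk, hd]
      simp
    simp only [← mul_assoc]
    rw [← sum_mul, hsum]
    split_ifs with h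
    · rw [abs_of_neg h]
      ring
    · rw [abs_of_nonneg (not_lt.1 h), mul_one]

lemma mem_GammaL_of_weight_pos {k : ℕ} {f : Finset (Fin k) → ℝ}
    (hsub : ∀ S T : Finset (Fin k), f (S ∪ T) + f (S ∩ T) ≤ f S + f T) (hnorm : f ∅ = 0)
    {p : (Fin k → ℝ) → ℝ} (hp : ∀ b : Fin k → Bool, 0 ≤ p (ytov k b))
    (π : Equiv.Perm (Fin k)) {y : Fin k → ℝ} (hy : ∀ i, y i = -1 ∨ y i = 1)
    {s : Finset ℕ} {w : ℕ → ℝ} (hw : ∀ i ∈ s, 0 ≤ w i) (hw1 : ∑ i ∈ s, w i = 1)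
    (hmin : (fun j => ∑ i ∈ s, w i * (onespi k π i j * y j)) ∈ GammaL k f p)
    {i : ℕ} (hi : i ∈ s) (hpos : 0 < w i) :
    (fun j => onespi k π i j * y j) ∈ GammaL k f p := by
  set v : Fin k → ℝ := fun j => ∑ i ∈ s, w i * (onespi k π i j * y j)
  have hle : ∑ i ∈ s, w i * (expLossL k f (fun j => onespi k π i j * y j) p -
      expLossL k f v p) ≤ 0 := by
    simp only [mul_sub, sum_sub_distrib]
    rw [← sum_mul, hw1, one_mul, sub_nonpos]
    exact sum_expLossL_le hsub hnorm hp π hy s w hw hw1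
  have hnn : ∀ i ∈ s, 0 ≤ w i * (expLossL k f (fun j => onespi k π i j * y j) p -
      expLossL k f v p) := fun i hi => mul_nonneg (hw i hi) (sub_nonneg.2 (hmin _))
  have hzero := (sum_eq_zero_iff_of_nonneg hnn).1 (le_antisymm hle (sum_nonneg hnn)) i hi
  have heq := (mul_eq_zero.1 hzero).resolve_left hpos.ne'
  intro u'
  rw [sub_eq_zero.1 heq]
  exact hmin u'

/-- `Ψ̂(u) ⊆ Ψ^f(u)`: whenever the optimal set `Γ_{L^f}(p)` comes within
sup-distance `ε` of `u`, the envelope `Ψ̂(u)` is contained in `Γ_{L^f}(p) ∩ {-1,0,1}^k`. -/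
theorem stmt18 (k : ℕ) (hk : 1 ≤ k) (f : Finset (Fin k) → ℝ)
    (hsub : ∀ S T : Finset (Fin k), f (S ∪ T) + f (S ∩ T) ≤ f S + f T)
    (hinc : ∀ S T : Finset (Fin k), Disjoint S T → f S ≤ f (S ∪ T))
    (hnorm : f ∅ = 0)
    (ε : ℝ) (hε : 0 < ε) :
    ∀ (u : Fin k → ℝ) (p : (Fin k → ℝ) → ℝ), IsProb k p →
      (∃ ustar ∈ GammaL k f p, ‖ustar - u‖ < ε) →
      psiHat k ε u ⊆ GammaL k f p ∩ {v | ∀ i, v i = -1 ∨ v i = 0 ∨ v i = 1} := by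
  rintro u p ⟨hp, -⟩ ⟨us, hus, hdist⟩
  have hcube : ∀ i, |clip us i| ≤ 1 := fun i => by
    rw [clip_apply, abs_le]
    grind
  have hclip := clip_mem_GammaL hinc hp hus
  obtain ⟨π, y, w, hy, hw, hw1, hv⟩ := exists_convex_decomposition hcube
  set V : Set (Fin k → ℝ) :=
    {v | ∃ i ≤ k, 0 < w i ∧ v = fun j => onespi k π i j * y j}
  have hVface : V ∈ Vface k := ⟨π, y, hy, fun v ⟨i, hi, _, h⟩ => ⟨i, hi, h⟩⟩
  have hhull : clip us ∈ convexHull ℝ V := by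
    have hfilter : ∑ i ∈ (range (k + 1)).filter (fun i => 0 < w i), w i = 1 := by
      rw [sum_filter_of_ne fun i hi h => lt_of_le_of_ne (hw i hi) h.symm, hw1]
    have hsum : clip us = ∑ i ∈ (range (k + 1)).filter (fun i => 0 < w i),
        w i • (fun j => onespi k π i j * y j) := by
      rw [sum_filter_of_ne fun i hi h =>
        lt_of_le_of_ne (hw i hi) fun h0 => h (by rw [← h0, zero_smul]), hv]
      funext j
      simp
    rw [hsum]
    refine (convex_convexHull ℝ V).sum_mem (fun i hi => (mem_filter.1 hi).2.le) hfilter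
      fun i hi => subset_convexHull ℝ V ?_
    rw [mem_filter, mem_range] at hi
    exact ⟨i, Nat.lt_succ_iff.1 hi.1, hi.2, rfl⟩
  have henv : psiHat k ε u ⊆ V :=
    Set.sInter_subset_of_mem ⟨hVface, clip us, hhull, norm_clip_sub_clip_lt hε hdist⟩
  refine henv.trans ?_
  rintro _ ⟨i, hi, hpos, rfl⟩
  refine ⟨mem_GammaL_of_weight_pos hsub hnorm hp π hy hw hw1 (hv ▸ hclip)
    (mem_range.2 (Nat.lt_succ_iff.2 hi)) hpos, fun j => ?_⟩
  rcases hy j with h | h <;> by_cases hj : j ∈ Spi k π i <;> simp [onespi, h, hj]
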